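/- Let k = m·2^n with m odd, n ≥ 0, and m ≡ 1 (mod 8). Then the clipped Thue–Morse morphism f_{4·2^n, k} is cubefree. -/

import Mathlib

/-- The Thue–Morse word: `tm n` is the parity of the number of 1s in the
binary representation of `n` (`true` = letter 1, `false` = letter 0). -/
def tm (n : ℕ) : Bool := ((Nat.digits 2 n).count 1) % 2 == 1

/-- The factor `t[ℓ..ℓ+k-1]` of the Thue–Morse word. -/
def tmFactor (ℓ k : ℕ) : List Bool := (List.range k).map (fun i => tm (ℓ + i))

/-- Complement of a binary word (exchange 0 and 1 in every position). -/
def wcompl (w : List Bool) : List Bool := w.map (fun b => !b)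

/-- Apply the binary morphism `0 ↦ h0, 1 ↦ h1` to the word `w`. -/
def applyMorph (h0 h1 : List Bool) (w : List Bool) : List Bool :=
  (w.map (fun b => bif b then h1 else h0)).flatten

/-- The Thue–Morse morphism μ : 0 ↦ 01, 1 ↦ 10. -/
def mu : List Bool → List Bool := applyMorph [false, true] [true, false]

/-- `p` is a period of the finite word `w`: `1 ≤ p ≤ |w|` and `w[i] = w[i+p]`
for all `i` with `i + p < |w|`. -/
def HasPeriodW (w : List Bool) (p : ℕ) : Prop :=
  1 ≤ p ∧ p ≤ w.length ∧ ∀ i, i + p < w.length → w.getD i false = w.getD (i + p) false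

/-- The smallest period of `w`. -/
noncomputable def per (w : List Bool) : ℕ := sInf {p | HasPeriodW w p}

/-- The exponent of `w`: `|w| / per(w)`. -/
noncomputable def wexp (w : List Bool) : ℝ := (w.length : ℝ) / (per w : ℝ)

/-- The critical exponent of `w`: supremum of exponents of nonempty factors of `w`. -/
noncomputable def ce (w : List Bool) : ℝ :=
  sSup {r : ℝ | ∃ x : List Bool, x ≠ [] ∧ x <:+: w ∧ r = wexp x}

/-- A `k`-prefix: the length-`k` prefix of the Thue–Morse word, or its complement. -/
def kPrefix (k : ℕ) (s : List Bool) : Prop :=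
  s = tmFactor 0 k ∨ s = wcompl (tmFactor 0 k)

/-- `v` is a finite factor of the Thue–Morse word. -/
def IsTMFactor (v : List Bool) : Prop := ∃ ℓ, v = tmFactor ℓ v.length

/-- The complementary morphism `0 ↦ h0, 1 ↦ complement of h0` is cubefree:
it maps every word of critical exponent `< 3` to a word of critical exponent `< 3`. -/
def CubefreeC (h0 : List Bool) : Prop :=
  ∀ w : List Bool, ce w < 3 → ce (applyMorph h0 (wcompl h0) w) < 3

/-- The word `x` occurs at position `i` of the word `w`. -/
def OccursAt (x w : List Bool) (i : ℕ) : Prop :=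
  i + x.length ≤ w.length ∧ (w.drop i).take x.length = x

/-- The infinite binary word `w` has no cube inside its prefix of length `N`. -/
def NoCube (w : ℕ → Bool) (N : ℕ) : Prop :=
  ∀ p i, 1 ≤ p → i + 3 * p ≤ N → ∃ y, i ≤ y ∧ y < i + 2 * p ∧ w y ≠ w (y + p)

/-- The image of an infinite word under the complementary morphism of block length `m`
whose image of `0` is the prefix of length `m` of `h`. -/
def blockMorph (h : ℕ → Bool) (m : ℕ) (w : ℕ → Bool) (y : ℕ) : Bool :=
  xor (w (y / m)) (h (y % m))

/-- The image of an infinite word under the Thue–Morse morphism. -/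
def double (w : ℕ → Bool) (y : ℕ) : Bool := xor (w (y / 2)) (y % 2 == 1)

section Exponent

lemma hasPeriodW_per {x : List Bool} (hx : x ≠ []) : HasPeriodW x (per x) := by
  have hpos : 1 ≤ x.length := List.length_pos_iff.mpr hx
  exact Nat.sInf_mem (s := {p | HasPeriodW x p})
    ⟨x.length, hpos, le_rfl, fun i hi => by omega⟩

lemma finite_exponents (w : List Bool) :
    {r : ℝ | ∃ x : List Bool, x ≠ [] ∧ x <:+: w ∧ r = wexp x}.Finite := by
  refine ((List.finite_toSet w.sublists).image wexp).subset ?_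
  rintro r ⟨x, -, hx, rfl⟩
  exact ⟨x, List.mem_sublists.mpr hx.sublist, rfl⟩

lemma ce_lt_three_iff (w : List Bool) :
    ce w < 3 ↔ NoCube (fun y => w.getD y false) w.length := by
  constructor
  · intro h p i hp hi
    by_contra! hcube
    set x := (w.drop i).take (3 * p) with hxdef
    have hlen : x.length = 3 * p := by simp [hxdef]; omega
    have hx : x ≠ [] := by
      intro h0
      rw [h0] at hlen
      simp at hlen
      omega
    have hget : ∀ y, y < 3 * p → x.getD y false = w.getD (i + y) false := by
      intro y hy
      simp [hxdef, List.getD_eq_getElem?_getD, hy]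
    have hper : HasPeriodW x p := by
      refine ⟨hp, by omega, fun y hy => ?_⟩
      rw [hget y (by omega), hget _ (by omega), ← add_assoc]
      exact hcube _ (by omega) (by omega)
    have hle : per x ≤ p := Nat.sInf_le hper
    have hpos : 1 ≤ per x := (hasPeriodW_per hx).1
    have hexp : 3 ≤ wexp x := by
      unfold wexp
      rw [le_div_iff₀ (by exact_mod_cast hpos), hlen]
      exact_mod_cast Nat.mul_le_mul_left 3 hle
    have hfactor : x <:+: w :=
      (List.take_prefix _ _).isInfix.trans (List.drop_suffix _ _).isInfix
    have : wexp x ≤ ce w := le_csSup (finite_exponents w).bddAbove ⟨x, hx, hfactor, rfl⟩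
    linarith
  · intro h
    rcases Set.eq_empty_or_nonempty
      {r : ℝ | ∃ x : List Bool, x ≠ [] ∧ x <:+: w ∧ r = wexp x} with he | hne
    · simp [ce, he]
    · rw [ce, Set.Finite.csSup_lt_iff (finite_exponents w) hne]
      rintro r ⟨x, hx, ⟨a, b, rfl⟩, rfl⟩
      obtain ⟨hp, -, hper⟩ := hasPeriodW_per hx
      by_contra! hexp
      unfold wexp at hexp
      rw [le_div_iff₀ (by exact_mod_cast hp)] at hexp
      have hlen : 3 * per x ≤ x.length := by exact_mod_cast hexp
      have hget : ∀ y, y < x.length →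
          (a ++ x ++ b).getD (a.length + y) false = x.getD y false := by
        intro y hy
        simp [List.getD_eq_getElem?_getD, List.getElem?_append, hy]
      obtain ⟨y, hy1, hy2, hne⟩ := h (per x) a.length hp (by simp; omega)
      obtain ⟨z, rfl⟩ := Nat.exists_eq_add_of_le hy1
      apply hne
      change (a ++ x ++ b).getD _ false = (a ++ x ++ b).getD _ false
      rw [add_assoc, hget _ (by omega), hget _ (by omega)]
      exact hper _ (by omega)

end Exponent

section Morphism

lemma length_applyMorph (h : List Bool) (w : List Bool) :
    (applyMorph h (wcompl h) w).length = w.length * h.length := by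
  induction w with
  | nil => simp [applyMorph]
  | cons b w ih =>
    have : applyMorph h (wcompl h) (b :: w) =
      (bif b then wcompl h else h) ++ applyMorph h (wcompl h) w := by simp [applyMorph]
    rw [this, List.length_append, ih]
    cases b <;> simp [wcompl] <;> ring

lemma getD_applyMorph (h : List Bool) (w : List Bool) (y : ℕ) (hy : y < w.length * h.length) :
    (applyMorph h (wcompl h) w).getD y false =
      blockMorph (fun r => h.getD r false) h.length (fun a => w.getD a false) y := by
  induction w generalizing y with
  | nil => simp at hy
  | cons b w ih =>
    have hcons : applyMorph h (wcompl h) (b :: w) =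
      (bif b then wcompl h else h) ++ applyMorph h (wcompl h) w := by simp [applyMorph]
    have hblock : (bif b then wcompl h else h).length = h.length := by
      cases b <;> simp [wcompl]
    have hpos : 0 < h.length := by
      rcases Nat.eq_zero_or_pos h.length with h0 | h0
      · simp [h0] at hy
      · exact h0
    rw [hcons]
    rcases lt_or_ge y h.length with hlt | hge
    · rw [List.getD_append _ _ _ _ (by omega)]
      simp only [blockMorph, Nat.div_eq_of_lt hlt, Nat.mod_eq_of_lt hlt]
      cases b <;> simp [wcompl, List.getD_eq_getElem?_getD, hlt]
    · rw [List.getD_append_right _ _ _ _ (by omega), hblock]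
      obtain ⟨z, rfl⟩ := Nat.exists_eq_add_of_le hge
      rw [Nat.add_sub_cancel_left, ih z (by simp [add_mul] at hy; omega)]
      simp [blockMorph, Nat.add_div_left z hpos]

lemma NoCube.congr {w v : ℕ → Bool} {N : ℕ} (hw : NoCube w N) (h : ∀ y < N, w y = v y) :
    NoCube v N := by
  intro p i hp hi
  obtain ⟨y, h1, h2, h3⟩ := hw p i hp hi
  refine ⟨y, h1, h2, ?_⟩
  rwa [← h y (by omega), ← h (y + p) (by omega)]

lemma cubefreeC_of_noCube {h : List Bool} {H : ℕ → Bool} {k : ℕ} (hk : h.length = k)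
    (hH : ∀ r < k, h.getD r false = H r)
    (hfree : ∀ w N, NoCube w N → NoCube (blockMorph H k w) (N * k)) : CubefreeC h := by
  subst hk
  intro w hw
  rw [ce_lt_three_iff] at hw ⊢
  rw [length_applyMorph]
  refine (hfree _ _ hw).congr fun y hy => ?_
  rw [getD_applyMorph h w y hy]
  have hpos : 0 < h.length := Nat.pos_of_ne_zero fun h0 => by simp [h0] at hy
  simp only [blockMorph, hH _ (Nat.mod_lt y hpos)]

lemma blockMorph_mul_add (h : ℕ → Bool) {m : ℕ} (w : ℕ → Bool) (c : ℕ) {r : ℕ} (hr : r < m) :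
    blockMorph h m w (m * c + r) = xor (w c) (h r) := by
  have hm : 0 < m := by omega
  simp [blockMorph, Nat.mul_add_div hm, Nat.div_eq_of_lt hr, Nat.mod_eq_of_lt hr]

/-- Cubes whose period is a multiple of the block length come from cubes in the preimage. -/
lemma NoCube.exists_ne_of_dvd {w : ℕ → Bool} {N : ℕ} (hw : NoCube w N) (h : ℕ → Bool)
    {m p i : ℕ} (hp : 1 ≤ p) (hi : i + 3 * p ≤ N * m) (hdvd : m ∣ p) :
    ∃ y, i ≤ y ∧ y < i + 2 * p ∧ blockMorph h m w y ≠ blockMorph h m w (y + p) := by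
  obtain ⟨q, rfl⟩ := hdvd
  have hm : 0 < m := by
    rcases Nat.eq_zero_or_pos m with h0 | h0
    · simp [h0] at hp
    · exact h0
  have hq : 1 ≤ q := by
    rcases Nat.eq_zero_or_pos q with h0 | h0
    · simp [h0] at hp
    · exact h0
  have hi' := Nat.div_add_mod i m
  have hr := Nat.mod_lt i hm
  set a := i / m
  have hbound : a + 3 * q ≤ N := by
    refine Nat.le_of_mul_le_mul_left (c := m) ?_ hm
    calc m * (a + 3 * q) = m * a + 3 * (m * q) := by ring
      _ ≤ m * N := by rw [mul_comm m N]; omega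
  obtain ⟨b, hb1, hb2, hb⟩ := hw q a hq hbound
  have hne : ∀ r < m, blockMorph h m w (m * b + r) ≠
      blockMorph h m w (m * b + r + m * q) := by
    intro r hr heq
    rw [show m * b + r + m * q = m * (b + q) + r by ring, blockMorph_mul_add _ _ _ hr,
      blockMorph_mul_add _ _ _ hr] at heq
    exact hb (by simpa using heq)
  have hle : m * b + m ≤ m * a + 2 * (m * q) := by nlinarith [Nat.mul_le_mul_left m hb2]
  rcases eq_or_lt_of_le hb1 with hab | hab
  · subst hab
    exact ⟨m * a + i % m, by omega, by nlinarith [Nat.mul_le_mul_left m hq], hne _ hr⟩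
  · have : m * a + m ≤ m * b := by nlinarith [Nat.mul_le_mul_left m hab]
    exact ⟨m * b + 0, by omega, by omega, hne 0 hm⟩

end Morphism

section Double

lemma double_two_mul (w : ℕ → Bool) (a : ℕ) : double w (2 * a) = w a := by
  simp [double]

lemma double_two_mul_add_one (w : ℕ → Bool) (a : ℕ) : double w (2 * a + 1) = !w a := by
  have h1 : (2 * a + 1) / 2 = a := by omega
  have h2 : (2 * a + 1) % 2 = 1 := by omega
  simp [double, h1, h2]

lemma double_ne_succ (w : ℕ → Bool) {y : ℕ} (hy : y % 2 = 0) :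
    double w y ≠ double w (y + 1) := by
  obtain ⟨a, rfl⟩ : ∃ a, y = 2 * a := ⟨y / 2, by omega⟩
  simp [double_two_mul, double_two_mul_add_one]

lemma eq_succ_of_double_ne (w : ℕ → Bool) {b : ℕ}
    (h : double w (2 * b + 1) ≠ double w (2 * b + 2)) : w b = w (b + 1) := by
  rw [double_two_mul_add_one, show 2 * b + 2 = 2 * (b + 1) by ring, double_two_mul] at h
  revert h
  cases w b <;> cases w (b + 1) <;> simp

/-- A run of length five on which `double w` agrees with an odd shift of itself, up to
complement, forces a cube of period one in `w`. -/
lemma exists_cube_of_odd_shift (w : ℕ → Bool) {x d : ℕ} {c : Bool} (hd : d % 2 = 1)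
    (h : ∀ y, x ≤ y → y < x + 5 → double w (y + d) = xor c (double w y)) :
    ∃ b, x ≤ 2 * b + 1 ∧ 2 * b + 4 < x + 5 ∧ w b = w (b + 1) ∧ w (b + 1) = w (b + 2) := by
  have key : ∀ b, x ≤ 2 * b + 1 → 2 * b + 2 < x + 5 → w b = w (b + 1) := by
    intro b h1 h2
    refine eq_succ_of_double_ne w fun heq => ?_
    refine double_ne_succ w (y := 2 * b + 1 + d) (by omega) ?_
    rw [show 2 * b + 1 + d + 1 = 2 * b + 2 + d by ring, h _ h1 (by omega), h _ (by omega) h2, heq]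
  exact ⟨x / 2, by omega, by omega, key _ (by omega) (by omega), key _ (by omega) (by omega)⟩

lemma NoCube.double {w : ℕ → Bool} {N : ℕ} (hw : NoCube w N) :
    NoCube (double w) (2 * N) := by
  intro p i hp hi
  have hblock : _root_.double w = blockMorph (fun r => r == 1) 2 w := rfl
  rcases Nat.even_or_odd' p with ⟨q, rfl | rfl⟩
  · rw [hblock]
    exact hw.exists_ne_of_dvd _ hp (by omega) ⟨q, rfl⟩
  by_contra! hcube
  rcases Nat.eq_zero_or_pos q with rfl | hq
  · have h0 := hcube i le_rfl (by omega)
    have h1 := hcube (i + 1) (by omega) (by omega)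
    rcases Nat.mod_two_eq_zero_or_one i with he | ho
    · exact double_ne_succ w he h0
    · exact double_ne_succ w (y := i + 1) (by omega) h1
  · obtain ⟨b, hb1, hb2, h1, h2⟩ := exists_cube_of_odd_shift w (x := i) (d := 2 * q + 1)
      (c := false) (by omega) (fun y hy1 hy2 => by
        simpa using (hcube y hy1 (by omega)).symm)
    obtain ⟨y, hy1, hy2, hne⟩ := hw 1 b le_rfl (by omega)
    obtain rfl | rfl : y = b ∨ y = b + 1 := by omega
    · exact hne h1
    · exact hne h2

end Double

section ThueMorse

lemma tm_two_mul (n : ℕ) : tm (2 * n) = tm n := by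
  rcases Nat.eq_zero_or_pos n with rfl | hn
  · rfl
  · rw [tm, Nat.digits_def' (by norm_num) (by omega)]
    simp [tm]

lemma tm_two_mul_add_one (n : ℕ) : tm (2 * n + 1) = !tm n := by
  have h1 : (2 * n + 1) / 2 = n := by omega
  have h2 : (2 * n + 1) % 2 = 1 := by omega
  rw [tm, Nat.digits_def' (by norm_num) (by omega), h1, h2, List.count_cons_self, tm]
  rcases Nat.mod_two_eq_zero_or_one (List.count 1 (Nat.digits 2 n)) with h | h
  · simp [h, Nat.add_mod]
  · simp [h, Nat.add_mod]

lemma double_tm : double tm = tm := by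
  funext y
  rcases Nat.even_or_odd' y with ⟨a, rfl | rfl⟩
  · rw [double_two_mul, tm_two_mul]
  · rw [double_two_mul_add_one, tm_two_mul_add_one]

lemma tm_ne_succ {y : ℕ} (hy : y % 2 = 0) : tm y ≠ tm (y + 1) := by
  have := double_ne_succ tm hy
  rwa [double_tm] at this

lemma tm_not_three_eq (b : ℕ) : ¬(tm b = tm (b + 1) ∧ tm (b + 1) = tm (b + 2)) := by
  rintro ⟨h1, h2⟩
  rcases Nat.mod_two_eq_zero_or_one b with he | ho
  · exact tm_ne_succ he h1
  · exact tm_ne_succ (y := b + 1) (by omega) h2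

lemma tm_odd_shift_run {x d : ℕ} {c : Bool} (hd : d % 2 = 1)
    (h : ∀ y, x ≤ y → y < x + 5 → tm (y + d) = xor c (tm y)) : False := by
  obtain ⟨b, -, -, hb⟩ := exists_cube_of_odd_shift tm (x := x) (c := c) hd
    (by simpa only [double_tm] using h)
  exact tm_not_three_eq b hb

/-- The Thue–Morse word is overlap-free. -/
lemma tm_overlap_free (d : ℕ) (hd : 1 ≤ d) (x : ℕ) :
    ¬∀ y, x ≤ y → y ≤ x + d → tm y = tm (y + d) := by
  induction d using Nat.strong_induction_on generalizing x with
  | _ d ih =>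
  intro h
  rcases Nat.even_or_odd' d with ⟨e, rfl | rfl⟩
  · refine ih e (by omega) (by omega) (x / 2) fun y hy1 hy2 => ?_
    rcases eq_or_lt_of_le hy1 with hy | hy
    · rcases Nat.mod_two_eq_zero_or_one x with he | ho
      · have := h (2 * y) (by omega) (by omega)
        rwa [← mul_add, tm_two_mul, tm_two_mul] at this
      · have := h (2 * y + 1) (by omega) (by omega)
        rw [show 2 * y + 1 + 2 * e = 2 * (y + e) + 1 by ring, tm_two_mul_add_one,
          tm_two_mul_add_one] at this
        simpa using this
    · have := h (2 * y) (by omega) (by omega)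
      rwa [← mul_add, tm_two_mul, tm_two_mul] at this
  · obtain rfl | rfl | he : e = 0 ∨ e = 1 ∨ 2 ≤ e := by omega
    · exact tm_not_three_eq x ⟨h x le_rfl (by omega), h (x + 1) (by omega) (by omega)⟩
    · have cross : ∀ b, x ≤ 2 * b + 1 → 2 * b + 2 ≤ x + 6 → tm b = tm (b + 1) := by
        intro b h1 h2
        apply eq_succ_of_double_ne tm
        rw [double_tm]
        intro heq
        rcases le_or_gt (2 * b + 2) (x + 3) with h3 | h3
        · have e1 := h (2 * b + 1) h1 (by omega)
          have e2 := h (2 * b + 2) (by omega) (by omega)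
          exact tm_ne_succ (y := 2 * b + 4) (by omega) (e1.symm.trans (heq.trans e2))
        · obtain ⟨b', rfl⟩ : ∃ b', b = b' + 1 := ⟨b - 1, by omega⟩
          have e1 := h (2 * b') (by omega) (by omega)
          have e2 := h (2 * b' + 1) (by omega) (by omega)
          exact tm_ne_succ (y := 2 * b') (by omega) (e1.trans (heq.trans e2.symm))
      exact tm_not_three_eq (x / 2)
        ⟨cross _ (by omega) (by omega), cross _ (by omega) (by omega)⟩
    · exact tm_odd_shift_run (x := x) (d := 2 * e + 1) (c := false) (by omega)
        fun y hy1 hy2 => by simpa using (h y hy1 (by omega)).symm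

lemma tm_eight_mul_add (a : ℕ) {r : ℕ} (hr : r < 8) :
    tm (8 * a + r) = xor (tm a) (tm r) := by
  obtain ⟨e, s, t, rfl, he, hs, ht⟩ :
      ∃ e s t, r = 2 * (2 * e + s) + t ∧ e < 2 ∧ s < 2 ∧ t < 2 :=
    ⟨r / 4, r / 2 % 2, r % 2, by omega, by omega, by omega, by omega⟩
  have step : ∀ x t, t < 2 → tm (2 * x + t) = xor (tm x) (t == 1) := by
    intro x t ht
    interval_cases t
    · simp [tm_two_mul]
    · simp [tm_two_mul_add_one]
  have h0 : tm 0 = false := rfl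
  have e1 := step 0 e he
  rw [show 8 * a + (2 * (2 * e + s) + t) = 2 * (2 * (2 * a + e) + s) + t by ring]
  rw [step _ _ ht, step _ _ ht, step _ _ hs, step _ _ hs, step _ _ he]
  simp only [mul_zero, zero_add, h0, Bool.false_xor] at e1
  simp only [e1, Bool.xor_assoc]

/-- The first 32 letters of the Thue–Morse word, packed in a number. -/
lemma tm_eq_testBit (x : ℕ) (hx : x < 32) : tm x = Nat.testBit 2523490710 x := by
  have rule : ∀ a < 16, Nat.testBit 2523490710 (2 * a) = Nat.testBit 2523490710 a ∧
      Nat.testBit 2523490710 (2 * a + 1) = !Nat.testBit 2523490710 a := by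
    decide +kernel
  induction x using Nat.strong_induction_on with
  | _ x ih =>
  rcases Nat.even_or_odd' x with ⟨a, rfl | rfl⟩
  · rcases Nat.eq_zero_or_pos a with rfl | ha
    · rfl
    · rw [tm_two_mul, ih a (by omega) (by omega), (rule a (by omega)).1]
  · rw [tm_two_mul_add_one, ih a (by omega) (by omega), (rule a (by omega)).2]

end ThueMorse

section Clipped

/-- The morphism of block length `m` whose image of `0` is `t[4..4+m-1]`. -/
abbrev clip (m : ℕ) (w : ℕ → Bool) : ℕ → Bool := blockMorph (fun r => tm (4 + r)) m w

lemma clip_mul_add {m : ℕ} (w : ℕ → Bool) (c : ℕ) {r : ℕ} (hr : r < m) :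
    clip m w (m * c + r) = xor (w c) (tm (4 + r)) :=
  blockMorph_mul_add _ w c hr

lemma eq_iff_of_xor_eq : ∀ {x y a b a' b' : Bool},
    xor x a = xor y b → xor x a' = xor y b' → (a = a' ↔ b = b') := by
  decide

lemma not_shift_two {x y : Bool} (h4 : xor x (tm 4) = xor y (tm 6))
    (h10 : xor x (tm 10) = xor y (tm 12)) : False :=
  absurd (eq_iff_of_xor_eq h4 h10) (by simp [tm_eq_testBit, Nat.testBit])

lemma not_shift_four {x y : Bool} (h4 : xor x (tm 4) = xor y (tm 8))
    (h8 : xor x (tm 8) = xor y (tm 12)) : False :=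
  absurd (eq_iff_of_xor_eq h4 h8) (by simp [tm_eq_testBit, Nat.testBit])

lemma not_shift_odd {x y : Bool} {d : ℕ} (hd : d % 2 = 1)
    (h5 : xor x (tm 5) = xor y (tm (5 + d))) (h6 : xor x (tm 6) = xor y (tm (6 + d))) :
    False := by
  have h := (eq_iff_of_xor_eq h5 h6).mp (by simp [tm_eq_testBit, Nat.testBit])
  rw [show 6 + d = 5 + d + 1 by ring] at h
  exact tm_ne_succ (y := 5 + d) (by omega) h

/-- No period at least the block length, unless it is a multiple of the block length:
a block would occur at a nontrivial offset inside the product of two blocks. -/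
lemma clip_exists_ne_of_le (w : ℕ → Bool) {m p : ℕ} (i : ℕ) (hodd : m % 2 = 1) (hm : 9 ≤ m)
    (hmp : m ≤ p) (hdvd : ¬m ∣ p) :
    ∃ y, i ≤ y ∧ y < i + 2 * p ∧ clip m w y ≠ clip m w (y + p) := by
  by_contra! h
  have hs0 : p % m ≠ 0 := fun h0 => hdvd (Nat.dvd_of_mod_eq_zero h0)
  have hs1 := Nat.mod_lt p (show 0 < m by omega)
  have hp := Nat.div_add_mod p m
  have hi := Nat.div_add_mod i m
  have hi1 := Nat.mod_lt i (show 0 < m by omega)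
  set s := p % m
  set q := p / m
  set c := i / m + 1 with hc
  have hmc : m * c = m * (i / m) + m := by rw [hc]; ring
  have left : ∀ r, r + s < m → xor (w c) (tm (4 + r)) = xor (w (c + q)) (tm (4 + (r + s))) := by
    intro r hr
    have := h (m * c + r) (by omega) (by omega)
    rwa [show m * c + r + p = m * (c + q) + (r + s) by rw [← hp]; ring,
      clip_mul_add _ _ (by omega), clip_mul_add _ _ hr] at this
  have right : ∀ u, u < s →
      xor (w c) (tm (4 + (u + (m - s)))) = xor (w (c + q + 1)) (tm (4 + u)) := by
    intro u hu
    have := h (m * c + (u + (m - s))) (by omega) (by omega)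
    rwa [show m * c + (u + (m - s)) + p = m * (c + q + 1) + u by
        simp only [mul_add, mul_one]; omega,
      clip_mul_add _ _ (by omega), clip_mul_add _ _ (by omega)] at this
  rcases Nat.mod_two_eq_zero_or_one s with hs | hs
  · rcases (show s = 2 ∨ 3 ≤ s by omega) with h2 | h3
    · have e0 := left 0 (by omega)
      have e6 := left 6 (by omega)
      rw [h2] at e0 e6
      exact not_shift_two e0 e6
    · have e1 := (right 1 (by omega)).symm
      have e2 := (right 2 (by omega)).symm
      rw [← add_assoc] at e1 e2
      exact not_shift_odd (d := m - s) (by omega) e1 e2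
  · rcases (show s = m - 2 ∨ s + 3 ≤ m by omega) with h2 | h3
    · have e0 := (right 0 (by omega)).symm
      have e6 := (right 6 (by omega)).symm
      rw [show m - s = 2 by omega] at e0 e6
      exact not_shift_two e0 e6
    · have e1 := left 1 (by omega)
      have e2 := left 2 (by omega)
      rw [← add_assoc] at e1 e2
      exact not_shift_odd hs e1 e2

section Window

variable {w : ℕ → Bool} {m p c r : ℕ}

lemma clip_same_block
    (h : ∀ v, r ≤ v → v < r + 2 * p → clip m w (m * c + v) = clip m w (m * c + v + p))
    (e u : ℕ) (hu : u + p < m) (h1 : r ≤ m * e + u) (h2 : m * e + u < r + 2 * p) :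
    tm (4 + u) = tm (4 + u + p) := by
  have := h _ h1 h2
  rw [show m * c + (m * e + u) = m * (c + e) + u by ring,
    show m * (c + e) + u + p = m * (c + e) + (u + p) by ring,
    clip_mul_add _ _ (by omega), clip_mul_add _ _ hu] at this
  rw [add_assoc]
  simpa using this

lemma clip_adjacent_blocks
    (h : ∀ v, r ≤ v → v < r + 2 * p → clip m w (m * c + v) = clip m w (m * c + v + p))
    (e u d : ℕ) (hd : d + p = m) (hu : u < p) (h1 : r ≤ m * e + u + d)
    (h2 : m * e + u + d < r + 2 * p) :
    xor (w (c + e + 1)) (tm (4 + u)) = xor (w (c + e)) (tm (4 + u + d)) := by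
  have := h _ h1 h2
  rw [show m * c + (m * e + u + d) + p = m * (c + e + 1) + u by rw [mul_add, mul_add]; omega,
    show m * c + (m * e + u + d) = m * (c + e) + (u + d) by ring,
    clip_mul_add _ _ (by omega), clip_mul_add _ _ (by omega)] at this
  rw [add_assoc 4 u d]
  exact this.symm

lemma clip_not_same_odd
    (h : ∀ v, r ≤ v → v < r + 2 * p → clip m w (m * c + v) = clip m w (m * c + v + p))
    (e u : ℕ) (hp : p % 2 = 1) (hu : u + 4 + p < m) (h1 : r ≤ m * e + u)
    (h2 : m * e + u + 4 < r + 2 * p) : False := by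
  refine tm_odd_shift_run (x := 4 + u) (d := p) (c := false) hp fun y hy1 hy2 => ?_
  obtain ⟨v, rfl⟩ : ∃ v, y = 4 + v := ⟨y - 4, by omega⟩
  simpa using (clip_same_block h e v (by omega) (by omega) (by omega)).symm

lemma clip_not_same_overlap (hp : 1 ≤ p)
    (h : ∀ v, r ≤ v → v < r + 2 * p → clip m w (m * c + v) = clip m w (m * c + v + p))
    (e u : ℕ) (hu : u + 2 * p < m) (h1 : r ≤ m * e + u)
    (h2 : m * e + u + p < r + 2 * p) : False := by
  refine tm_overlap_free p hp (4 + u) fun y hy1 hy2 => ?_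
  obtain ⟨v, rfl⟩ : ∃ v, y = 4 + v := ⟨y - 4, by omega⟩
  exact clip_same_block h e v (by omega) (by omega) (by omega)

lemma clip_not_adjacent_odd
    (h : ∀ v, r ≤ v → v < r + 2 * p → clip m w (m * c + v) = clip m w (m * c + v + p))
    (e u d : ℕ) (hd : d + p = m) (hodd : d % 2 = 1) (hu : u + 4 < p)
    (h1 : r ≤ m * e + u + d) (h2 : m * e + u + d + 4 < r + 2 * p) : False := by
  refine tm_odd_shift_run (x := 4 + u) (d := d) (c := xor (w (c + e + 1)) (w (c + e))) hodd
    fun y hy1 hy2 => ?_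
  obtain ⟨v, rfl⟩ : ∃ v, y = 4 + v := ⟨y - 4, by omega⟩
  have := clip_adjacent_blocks h e v d hd (by omega) (by omega) (by omega)
  revert this
  generalize w (c + e + 1) = a
  generalize w (c + e) = b
  generalize tm (4 + v) = x
  generalize tm (4 + v + d) = y
  revert a b x y
  decide

lemma clip_not_adjacent_start
    (h : ∀ v, r ≤ v → v < r + 2 * p → clip m w (m * c + v) = clip m w (m * c + v + p))
    (e d : ℕ) (hd : d + p = m) (hd' : d = 2 ∨ d = 4) (hp : 7 ≤ p)
    (h1 : r ≤ m * e + d) (h2 : m * e + d + 6 < r + 2 * p) : False := by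
  have h' := fun u (hu : u < 7) => clip_adjacent_blocks h e u d hd (by omega) (by omega) (by omega)
  rcases hd' with rfl | rfl
  · exact not_shift_two (h' 0 (by omega)) (h' 6 (by omega))
  · exact not_shift_four (h' 0 (by omega)) (h' 4 (by omega))

/-- Periods between `9` and the block length are impossible. -/
lemma clip_not_periodic_of_nine_le (hodd : m % 2 = 1) (hm : 17 ≤ m) (hp : 9 ≤ p) (hpm : p < m)
    (hr : r < m)
    (h : ∀ v, r ≤ v → v < r + 2 * p → clip m w (m * c + v) = clip m w (m * c + v + p)) :
    False := by
  obtain ⟨d, hd⟩ : ∃ d, d + p = m := ⟨m - p, by omega⟩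
  rcases Nat.mod_two_eq_zero_or_one p with he | ho
  · by_cases h1 : r + 2 * p < m
    · exact clip_not_same_overlap (by omega) h 0 r h1 (by omega) (by omega)
    by_cases h2 : r + 5 ≤ m
    · rcases le_total r d with h3 | h3
      · exact clip_not_adjacent_odd h 0 0 d hd (by omega) (by omega) (by omega) (by omega)
      · exact clip_not_adjacent_odd h 0 (r - d) d hd (by omega) (by omega) (by omega) (by omega)
    by_cases h3 : 2 * p + 1 ≤ m
    · exact clip_not_same_overlap (by omega) h 1 0 (by omega) (by omega) (by omega)
    · exact clip_not_adjacent_odd h 1 0 d hd (by omega) (by omega) (by omega) (by omega)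
  · by_cases h1 : d = 2 ∨ d = 4
    · by_cases h2 : r ≤ d
      · exact clip_not_adjacent_start h 0 d hd h1 (by omega) (by omega) (by omega)
      · exact clip_not_adjacent_start h 1 d hd h1 (by omega) (by omega) (by omega)
    by_cases h2 : r + 5 ≤ d
    · exact clip_not_same_odd h 0 r ho (by omega) (by omega) (by omega)
    · exact clip_not_same_odd h 1 0 ho (by omega) (by omega) (by omega)

end Window

/-- The letter of index `a` in a word of length four. -/
def pick (b₀ b₁ b₂ b₃ : Bool) : ℕ → Bool
  | 0 => b₀
  | 1 => b₁
  | 2 => b₂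
  | _ => b₃

/-- The images of words of length four, with the letters of `t` read off a packed number. -/
def imageWord (m : ℕ) (b₀ b₁ b₂ b₃ : Bool) (u : ℕ) : Bool :=
  xor (pick b₀ b₁ b₂ b₃ (u / m)) (Nat.testBit 2523490710 (4 + u % m))

/-- The 24 letters on either side of a block boundary, where `b₀, …, b₃` are the four letters
of `t` that determine the end of the left block. -/
def boundaryWord (b₀ b₁ b₂ b₃ z₀ z₁ : Bool) (u : ℕ) : Bool :=
  if u < 24 then
    xor z₀ (xor (pick b₀ b₁ b₂ b₃ ((5 + u) / 8)) (Nat.testBit 2523490710 ((5 + u) % 8)))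
  else xor z₁ (Nat.testBit 2523490710 (4 + (u - 24)))

lemma exists_testBit_ne {F u p : ℕ} (h : (F ^^^ F >>> p) >>> u % 2 ^ (2 * p) ≠ 0) :
    ∃ v < 2 * p, F.testBit (u + v) ≠ F.testBit (u + v + p) := by
  obtain ⟨v, hv⟩ := Nat.exists_testBit_of_ne_zero h
  simp only [Nat.testBit_mod_two_pow, Nat.testBit_shiftRight, Nat.testBit_xor,
    Bool.and_eq_true, decide_eq_true_eq, bne_iff_ne] at hv
  exact ⟨v, hv.1, by simpa [add_comm p] using hv.2⟩

/-- A bitwise test for the absence of cubes with period less than `9` starting before `n`. -/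
lemma exists_ne_of_ofBits {g : ℕ → Bool} {n N : ℕ} (hN : n + 24 ≤ N)
    (h : ∀ u < n, ∀ p < 9, 1 ≤ p →
      ((Nat.ofBits fun i : Fin N => g i) ^^^ (Nat.ofBits fun i : Fin N => g i) >>> p) >>> u %
        2 ^ (2 * p) ≠ 0) :
    ∀ u < n, ∀ p < 9, 1 ≤ p → ∃ v < 2 * p, g (u + v) ≠ g (u + v + p) := by
  intro u hu p hp9 hp
  obtain ⟨v, hv, hne⟩ := exists_testBit_ne (h u hu p hp9 hp)
  rw [Nat.testBit_ofBits_lt _ _ (by omega), Nat.testBit_ofBits_lt _ _ (by omega)] at hne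
  exact ⟨v, hv, hne⟩

lemma imageWord_nine_exists_ne (b₀ b₁ b₂ b₃ : Bool) : ∀ u < 9, ∀ p < 9, 1 ≤ p →
    ∃ v < 2 * p, imageWord 9 b₀ b₁ b₂ b₃ (u + v) ≠ imageWord 9 b₀ b₁ b₂ b₃ (u + v + p) := by
  refine exists_ne_of_ofBits (N := 33) (by norm_num) ?_
  revert b₀ b₁ b₂ b₃
  decide +kernel

lemma imageWord_seventeen_exists_ne (b₀ b₁ b₂ b₃ : Bool) : ∀ u < 17, ∀ p < 9, 1 ≤ p →
    ∃ v < 2 * p, imageWord 17 b₀ b₁ b₂ b₃ (u + v) ≠ imageWord 17 b₀ b₁ b₂ b₃ (u + v + p) := by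
  refine exists_ne_of_ofBits (N := 41) (by norm_num) ?_
  revert b₀ b₁ b₂ b₃
  decide +kernel

lemma boundaryWord_exists_ne (b₀ b₁ b₂ b₃ z₀ z₁ : Bool)
    (h₀ : ¬(b₀ = b₁ ∧ b₁ = b₂)) (h₁ : ¬(b₁ = b₂ ∧ b₂ = b₃)) : ∀ u < 24, ∀ p < 9, 1 ≤ p →
    ∃ v < 2 * p, boundaryWord b₀ b₁ b₂ b₃ z₀ z₁ (u + v) ≠
      boundaryWord b₀ b₁ b₂ b₃ z₀ z₁ (u + v + p) := by
  refine exists_ne_of_ofBits (N := 48) (by norm_num) ?_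
  revert b₀ b₁ b₂ b₃ z₀ z₁
  decide +kernel

lemma clip_eq_imageWord {m : ℕ} (hm : 0 < m) (hm' : m ≤ 28) (w : ℕ → Bool) (c : ℕ) {u : ℕ}
    (hu : u < 4 * m) :
    clip m w (m * c + u) = imageWord m (w c) (w (c + 1)) (w (c + 2)) (w (c + 3)) u := by
  have h1 := Nat.mod_lt u hm
  have h2 : u / m < 4 := Nat.div_lt_of_lt_mul (by omega)
  conv_lhs => rw [← Nat.div_add_mod u m, ← add_assoc, ← mul_add, clip_mul_add _ _ h1]
  rw [imageWord, tm_eq_testBit _ (by omega)]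
  congr 1
  generalize u / m = a at h2
  interval_cases a <;> rfl

lemma clip_eq_boundaryWord {m j : ℕ} (hm : m = 8 * (j + 3) + 1) (w : ℕ → Bool) (c : ℕ) {u : ℕ}
    (hu : u < 48) :
    clip m w (m * c + (m - 24 + u)) =
      boundaryWord (tm j) (tm (j + 1)) (tm (j + 2)) (tm (j + 3)) (w c) (w (c + 1)) u := by
  rcases lt_or_ge u 24 with h | h
  · rw [clip_mul_add _ _ (by omega), boundaryWord, if_pos h,
      show 4 + (m - 24 + u) = 8 * (j + (5 + u) / 8) + (5 + u) % 8 by omega,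
      tm_eight_mul_add _ (by omega), tm_eq_testBit ((5 + u) % 8) (by omega)]
    congr 2
    have h2 : (5 + u) / 8 < 4 := by omega
    generalize (5 + u) / 8 = a at h2
    interval_cases a <;> rfl
  · rw [show m * c + (m - 24 + u) = m * (c + 1) + (u - 24) by rw [mul_add]; omega,
      clip_mul_add _ _ (by omega), boundaryWord, if_neg (by omega), tm_eq_testBit _ (by omega)]

/-- Periods at most `8` are impossible. -/
lemma clip_not_periodic_of_lt_nine {w : ℕ → Bool} {m p c r : ℕ} (hm8 : m % 8 = 1) (hm : 9 ≤ m)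
    (hp : 1 ≤ p) (hp9 : p < 9) (hr : r < m)
    (h : ∀ v, r ≤ v → v < r + 2 * p → clip m w (m * c + v) = clip m w (m * c + v + p)) :
    False := by
  obtain rfl | rfl | ⟨j, hj⟩ : m = 9 ∨ m = 17 ∨ ∃ j, m = 8 * (j + 3) + 1 := by
    by_cases h9 : m = 9
    · exact Or.inl h9
    by_cases h17 : m = 17
    · exact Or.inr (Or.inl h17)
    exact Or.inr (Or.inr ⟨m / 8 - 3, by omega⟩)
  · obtain ⟨v, hv, hne⟩ := imageWord_nine_exists_ne (w c) (w (c + 1)) (w (c + 2)) (w (c + 3))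
      r hr p hp9 hp
    rw [← clip_eq_imageWord (by omega) (by omega) _ _ (u := r + v) (by omega),
      ← clip_eq_imageWord (by omega) (by omega) _ _ (u := r + v + p) (by omega),
      ← add_assoc (_ * c) (r + v) p] at hne
    exact hne (h _ (by omega) (by omega))
  · obtain ⟨v, hv, hne⟩ := imageWord_seventeen_exists_ne (w c) (w (c + 1)) (w (c + 2)) (w (c + 3))
      r hr p hp9 hp
    rw [← clip_eq_imageWord (by omega) (by omega) _ _ (u := r + v) (by omega),
      ← clip_eq_imageWord (by omega) (by omega) _ _ (u := r + v + p) (by omega),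
      ← add_assoc (_ * c) (r + v) p] at hne
    exact hne (h _ (by omega) (by omega))
  · by_cases hin : r + 2 * p < m
    · exact clip_not_same_overlap hp h 0 r hin (by omega) (by omega)
    obtain ⟨u, rfl⟩ : ∃ u, r = m - 24 + u := ⟨r - (m - 24), by omega⟩
    obtain ⟨v, hv, hne⟩ := boundaryWord_exists_ne (tm j) (tm (j + 1)) (tm (j + 2)) (tm (j + 3))
      (w c) (w (c + 1)) (tm_not_three_eq j) (tm_not_three_eq (j + 1)) u (by omega) p hp9 hp
    rw [← clip_eq_boundaryWord hj _ _ (by omega), ← clip_eq_boundaryWord hj _ _ (by omega)] at hne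
    refine hne ?_
    have := h (m - 24 + (u + v)) (by omega) (by omega)
    rwa [add_assoc (m * c), add_assoc (m - 24)] at this

/-- The morphism with block `t[4..4+m-1]`, `m ≡ 1 (mod 8)`, is cubefree. -/
lemma NoCube.clip {w : ℕ → Bool} {N m : ℕ} (hw : NoCube w N) (hm8 : m % 8 = 1) :
    NoCube (clip m w) (N * m) := by
  intro p i hp hi
  by_cases hdvd : m ∣ p
  · exact hw.exists_ne_of_dvd _ hp hi hdvd
  have hm : 9 ≤ m := by
    by_contra hlt
    obtain rfl : m = 1 := by omega
    exact hdvd (one_dvd p)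
  rcases le_or_gt m p with hmp | hpm
  · exact clip_exists_ne_of_le w i (by omega) hm hmp hdvd
  by_contra! h
  have hi' := Nat.div_add_mod i m
  have hr := Nat.mod_lt i (show 0 < m by omega)
  have h' : ∀ v, i % m ≤ v → v < i % m + 2 * p →
      _root_.clip m w (m * (i / m) + v) = _root_.clip m w (m * (i / m) + v + p) :=
    fun v h1 h2 => h _ (by omega) (by omega)
  rcases lt_or_ge p 9 with h9 | h9
  · exact clip_not_periodic_of_lt_nine hm8 hm hp h9 hr h'
  · exact clip_not_periodic_of_nine_le (by omega) (by omega) h9 hpm hr h'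

lemma blockMorph_two_mul (a m : ℕ) (w : ℕ → Bool) :
    blockMorph (fun r => tm (2 * a + r)) (m * 2) w =
      double (blockMorph (fun r => tm (a + r)) m w) := by
  funext y
  have h1 : y / (m * 2) = y / 2 / m := by rw [mul_comm, Nat.div_div_eq_div_mul]
  have h2 : y % (m * 2) = 2 * (y / 2 % m) + y % 2 := by
    rw [mul_comm m 2, Nat.mod_mul, add_comm]
  simp only [blockMorph, double, h1, h2]
  rcases Nat.mod_two_eq_zero_or_one y with h | h
  · rw [h, add_zero, ← mul_add, tm_two_mul]
    simp
  · rw [h, ← add_assoc, ← mul_add, tm_two_mul_add_one]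
    simp

lemma NoCube.clip_mul_two_pow {w : ℕ → Bool} {N m : ℕ} (hw : NoCube w N) (hm8 : m % 8 = 1)
    (n : ℕ) :
    NoCube (blockMorph (fun r => tm (4 * 2 ^ n + r)) (m * 2 ^ n) w) (N * (m * 2 ^ n)) := by
  induction n with
  | zero => simpa using hw.clip hm8
  | succ n ih =>
    have := ih.double
    rwa [← blockMorph_two_mul, show 2 * (4 * 2 ^ n) = 4 * 2 ^ (n + 1) by ring,
      show m * 2 ^ n * 2 = m * 2 ^ (n + 1) by ring,
      show 2 * (N * (m * 2 ^ n)) = N * (m * 2 ^ (n + 1)) by ring] at this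

end Clipped

/-- for `k = m·2ⁿ` with `m` odd and `m ≡ 1 (mod 8)`, the clipped
Thue–Morse morphism `f_{4·2ⁿ, k}` is cubefree. -/
theorem stmt10 (m n k : ℕ) (hm : Odd m) (hm8 : m % 8 = 1) (hk : k = m * 2 ^ n) :
    CubefreeC (tmFactor (4 * 2 ^ n) k) := by
  subst hk
  refine cubefreeC_of_noCube (H := fun r => tm (4 * 2 ^ n + r)) (by simp [tmFactor]) ?_
    fun w N hw => hw.clip_mul_two_pow hm8 n
  intro r hr
  simp [tmFactor, List.getD_eq_getElem?_getD, hr]
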